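/- Let Γ be a countable discrete group and let f ∈ ℤΓ be invertible in ℓ¹(Γ,ℝ). Then for every ε > 0 there is a nonempty finite subset F̃ of Γ such that for any finite collection of finite subsets F_1, …, F_m of Γ with F̃ F_i ∩ F_j = ∅ for all 1 ≤ i ≠ j ≤ m, and any points x¹, …, x^m ∈ X_f, there exists y ∈ X_f with ρ(s x^i, s y) ≤ ε for all s ∈ F_i and all 1 ≤ i ≤ m. -/

import Mathlib

open scoped Pointwise
open Filter Topology

noncomputable section

/-- The circle `ℝ/ℤ`. -/
abbrev Tcirc : Type := AddCircle (1 : ℝ)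

/-- For `f = Σ_s f_s s ∈ ℤΓ` (as a finitely supported function `Γ →₀ ℤ`), the value at `t`
of `r_{f*} x`, where `f* = Σ_s f_s s⁻¹` and `(r^s x)_t = x_{t s}`; explicitly
`(r_{f*} x)_t = Σ_s f_s x_{t s⁻¹}`. -/
def rStarApply {Γ : Type*} [Group Γ] (f : Γ →₀ ℤ) (x : Γ → Tcirc) (t : Γ) : Tcirc :=
  f.sum fun s c => c • x (t * s⁻¹)

/-- `X_f = {x ∈ (ℝ/ℤ)^Γ : r_{f*} x = 0}`, as a (closed, shift-invariant) additive
subgroup of `(ℝ/ℤ)^Γ`. -/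
def XfSub {Γ : Type*} [Group Γ] (f : Γ →₀ ℤ) : AddSubgroup (Γ → Tcirc) where
  carrier := {x | ∀ t, rStarApply f x t = 0}
  zero_mem' := by
    intro t
    simp [rStarApply]
  add_mem' := by
    intro a b ha hb t
    have h : rStarApply f (a + b) t = rStarApply f a t + rStarApply f b t := by
      simp [rStarApply, Finsupp.sum, smul_add, Finset.sum_add_distrib]
    rw [h, ha t, hb t, add_zero]
  neg_mem' := by
    intro a ha t
    have h : rStarApply f (-a) t = -rStarApply f a t := by
      simp [rStarApply, Finsupp.sum]
    rw [h, ha t, neg_zero]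

/-- The left-shift action `α_f` of `Γ` on `X_f`: `(s • x)_t = x_{s⁻¹ t}`. -/
instance {Γ : Type*} [Group Γ] (f : Γ →₀ ℤ) : MulAction Γ (XfSub f) where
  smul s x := ⟨fun t => (x : Γ → Tcirc) (s⁻¹ * t), by
    intro t
    have h := x.2 (s⁻¹ * t)
    simpa [rStarApply, mul_assoc] using h⟩
  one_smul x := Subtype.ext (funext fun t => by
    show (x : Γ → Tcirc) ((1 : Γ)⁻¹ * t) = (x : Γ → Tcirc) t
    rw [inv_one, one_mul])
  mul_smul s₁ s₂ x := Subtype.ext (funext fun t => by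
    show (x : Γ → Tcirc) ((s₁ * s₂)⁻¹ * t) = (x : Γ → Tcirc) (s₂⁻¹ * (s₁⁻¹ * t))
    rw [mul_inv_rev, mul_assoc])

@[simp] lemma smul_XfSub_apply {Γ : Type*} [Group Γ] (f : Γ →₀ ℤ) (s : Γ) (x : XfSub f)
    (t : Γ) : ((s • x : XfSub f) : Γ → Tcirc) t = (x : Γ → Tcirc) (s⁻¹ * t) := rfl

/-- The convolution of two functions on `Γ`: `(u ⋆ v) t = Σ_s u s · v (s⁻¹ t)`. -/
def l1conv {Γ : Type*} [Group Γ] (u v : Γ → ℝ) : Γ → ℝ :=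
  fun t => ∑' s, u s * v (s⁻¹ * t)

/-- The identity of convolution: the indicator of `{1}`. -/
def deltaOne (Γ : Type*) [Group Γ] [DecidableEq Γ] : Γ → ℝ :=
  fun t => if t = 1 then 1 else 0

/-- `g ∈ ℓ¹(Γ,ℝ)` is a two-sided convolution inverse of `f ∈ ℤΓ`. -/
def IsL1Inverse {Γ : Type*} [Group Γ] [DecidableEq Γ] (f : Γ →₀ ℤ) (g : Γ → ℝ) : Prop :=
  Summable (fun s => |g s|) ∧
    l1conv (fun s => (f s : ℝ)) g = deltaOne Γ ∧
    l1conv g (fun s => (f s : ℝ)) = deltaOne Γ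

/-- `f ∈ ℤΓ` is invertible in `ℓ¹(Γ,ℝ)`. -/
def L1Invertible {Γ : Type*} [Group Γ] [DecidableEq Γ] (f : Γ →₀ ℤ) : Prop :=
  ∃ g : Γ → ℝ, IsL1Inverse f g

/-- The distance function of an explicitly given metric space structure. -/
def mdist {X : Type*} (m : MetricSpace X) : X → X → ℝ :=
  m.toPseudoMetricSpace.toDist.dist

/-- The topology induced by an explicitly given metric space structure. -/
def mtop {X : Type*} (m : MetricSpace X) : TopologicalSpace X :=
  m.toPseudoMetricSpace.toUniformSpace.toTopologicalSpace

end

/-- If `a` is bounded and `g` is absolutely summable, the terms of `(a ⋆ g) t` are summable. -/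
theorem summable_mul_translate {Γ : Type*} [Group Γ] {a g : Γ → ℝ} {C : ℝ}
    (ha : ∀ u, |a u| ≤ C) (hg : Summable fun s => |g s|) (t : Γ) :
    Summable fun u => a u * g (u⁻¹ * t) := by
  have h : Summable fun u : Γ => |g (u⁻¹ * t)| :=
    ((Equiv.inv Γ).trans (Equiv.mulRight t)).summable_iff (f := fun s => |g s|) |>.2 hg
  refine Summable.of_norm_bounded (h.mul_left C) fun u => ?_
  rw [Real.norm_eq_abs, abs_mul]
  exact mul_le_mul_of_nonneg_right (ha u) (abs_nonneg _)

/-- The convolution of an element of `ℤΓ` with a function, as a finite sum. -/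
theorem l1conv_finsupp_left {Γ : Type*} [Group Γ] (f : Γ →₀ ℤ) (g : Γ → ℝ) (t : Γ) :
    l1conv (fun s => (f s : ℝ)) g t = f.sum fun s c => (c : ℝ) * g (s⁻¹ * t) := by
  rw [l1conv, Finsupp.sum]
  refine tsum_eq_sum fun s hs => ?_
  simp [Finsupp.notMem_support_iff.1 hs]

/-- The convolution of a function with an element of `ℤΓ`, as a finite sum. -/
theorem l1conv_finsupp_right {Γ : Type*} [Group Γ] (f : Γ →₀ ℤ) (a : Γ → ℝ) (t : Γ) :
    l1conv a (fun s => (f s : ℝ)) t = f.sum fun s c => (c : ℝ) * a (t * s⁻¹) := by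
  rw [l1conv, Finsupp.sum,
    ← ((Equiv.inv Γ).trans (Equiv.mulLeft t)).tsum_eq fun s => a s * (f (s⁻¹ * t) : ℝ)]
  simp only [Equiv.trans_apply, Equiv.inv_apply, Equiv.coe_mulLeft, mul_inv_rev, inv_inv,
    inv_mul_cancel_right]
  rw [tsum_eq_sum (s := f.support) fun s hs => by simp [Finsupp.notMem_support_iff.1 hs]]
  exact Finset.sum_congr rfl fun s _ => mul_comm _ _

theorem l1conv_deltaOne {Γ : Type*} [Group Γ] [DecidableEq Γ] (a : Γ → ℝ) :
    l1conv a (deltaOne Γ) = a := by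
  funext t
  rw [l1conv, tsum_eq_single t fun s hs => ?_]
  · simp [deltaOne]
  · simp [deltaOne, inv_mul_eq_one, hs]

/-- Associativity `(a ⋆ f) ⋆ g = a ⋆ (f ⋆ g)` for `a` bounded, `f ∈ ℤΓ` and `g ∈ ℓ¹(Γ)`. -/
theorem l1conv_assoc_finsupp_mid {Γ : Type*} [Group Γ] {a g : Γ → ℝ} {C : ℝ} (f : Γ →₀ ℤ)
    (ha : ∀ u, |a u| ≤ C) (hg : Summable fun s => |g s|) :
    l1conv (l1conv a fun s => (f s : ℝ)) g = l1conv a (l1conv (fun s => (f s : ℝ)) g) := by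
  funext t
  have hterm : ∀ s : Γ, Summable fun u => a (u * s⁻¹) * g (u⁻¹ * t) := fun s =>
    summable_mul_translate (fun u => ha (u * s⁻¹)) hg t
  have hterm' : ∀ s : Γ, Summable fun u => a u * g (s⁻¹ * (u⁻¹ * t)) := fun s => by
    simpa [Function.comp_def, mul_assoc] using (Equiv.mulRight s).summable_iff.2 (hterm s)
  have hshift : ∀ s : Γ, ∑' u, a (u * s⁻¹) * g (u⁻¹ * t) =
      ∑' u, a u * g (s⁻¹ * (u⁻¹ * t)) := fun s => by
    rw [← (Equiv.mulRight s).tsum_eq]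
    simp [mul_assoc]
  calc l1conv (l1conv a fun s => (f s : ℝ)) g t
      = ∑' u, ∑ s ∈ f.support, (f s : ℝ) * (a (u * s⁻¹) * g (u⁻¹ * t)) := by
        unfold l1conv
        refine tsum_congr fun u => ?_
        have := l1conv_finsupp_right f a u
        unfold l1conv at this
        rw [this, Finsupp.sum, Finset.sum_mul]
        exact Finset.sum_congr rfl fun s _ => mul_assoc _ _ _
    _ = ∑ s ∈ f.support, (f s : ℝ) * ∑' u, a (u * s⁻¹) * g (u⁻¹ * t) := by
        rw [Summable.tsum_finsetSum fun s _ => (hterm s).mul_left _]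
        exact Finset.sum_congr rfl fun s _ => tsum_mul_left
    _ = ∑' u, ∑ s ∈ f.support, (f s : ℝ) * (a u * g (s⁻¹ * (u⁻¹ * t))) := by
        rw [Summable.tsum_finsetSum fun s _ => (hterm' s).mul_left _]
        exact Finset.sum_congr rfl fun s _ => by rw [hshift, tsum_mul_left]
    _ = l1conv a (l1conv (fun s => (f s : ℝ)) g) t := by
        rw [l1conv]
        refine tsum_congr fun u => ?_
        rw [l1conv_finsupp_left, Finsupp.sum, Finset.mul_sum]
        exact Finset.sum_congr rfl fun s _ => mul_left_comm _ _ _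

/-- Associativity `(a ⋆ g) ⋆ f = a ⋆ (g ⋆ f)` for `a` bounded, `g ∈ ℓ¹(Γ)` and `f ∈ ℤΓ`. -/
theorem l1conv_assoc_finsupp_right {Γ : Type*} [Group Γ] {a g : Γ → ℝ} {C : ℝ} (f : Γ →₀ ℤ)
    (ha : ∀ u, |a u| ≤ C) (hg : Summable fun s => |g s|) :
    l1conv (l1conv a g) (fun s => (f s : ℝ)) = l1conv a (l1conv g fun s => (f s : ℝ)) := by
  funext t
  rw [l1conv_finsupp_right, Finsupp.sum]
  calc ∑ s ∈ f.support, (f s : ℝ) * l1conv a g (t * s⁻¹)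
      = ∑' u, ∑ s ∈ f.support, (f s : ℝ) * (a u * g (u⁻¹ * (t * s⁻¹))) := by
        rw [Summable.tsum_finsetSum fun s _ =>
          (summable_mul_translate ha hg (t * s⁻¹)).mul_left _]
        exact Finset.sum_congr rfl fun s _ => tsum_mul_left.symm
    _ = l1conv a (l1conv g fun s => (f s : ℝ)) t := by
        conv_rhs => rw [l1conv]
        refine tsum_congr fun u => ?_
        rw [l1conv_finsupp_right, Finsupp.sum, Finset.mul_sum]
        exact Finset.sum_congr rfl fun s _ => by rw [mul_left_comm, mul_assoc]

theorem rStarApply_coe {Γ : Type*} [Group Γ] (f : Γ →₀ ℤ) (a : Γ → ℝ) (t : Γ) :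
    rStarApply f (fun s => (a s : Tcirc)) t =
      ((l1conv a (fun s => (f s : ℝ)) t : ℝ) : Tcirc) := by
  rw [l1conv_finsupp_right, rStarApply, Finsupp.sum, Finsupp.sum]
  refine Eq.trans ?_ (map_sum (QuotientAddGroup.mk' (AddSubgroup.zmultiples (1 : ℝ))) _ _).symm
  refine Finset.sum_congr rfl fun s _ => ?_
  rw [← zsmul_eq_mul]
  rfl

theorem abs_l1conv_finsupp_right_le {Γ : Type*} [Group Γ] (f : Γ →₀ ℤ) {a : Γ → ℝ}
    (ha : ∀ u, |a u| ≤ 1) (t : Γ) :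
    |l1conv a (fun s => (f s : ℝ)) t| ≤ f.sum fun _ c => |(c : ℝ)| := by
  rw [l1conv_finsupp_right]
  refine (Finset.abs_sum_le_sum_abs _ _).trans (Finset.sum_le_sum fun s _ => ?_)
  rw [abs_mul]
  exact mul_le_of_le_one_right (abs_nonneg _) (ha _)

/-- Every point of `X_f` is the projection of `h ⋆ g` for some bounded integral `h`, where
`g = f⁻¹` in `ℓ¹(Γ)`. -/
theorem exists_int_lift {Γ : Type*} [Group Γ] [DecidableEq Γ] {f : Γ →₀ ℤ} {g : Γ → ℝ}
    (hg : IsL1Inverse f g) (x : XfSub f) :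
    ∃ h : Γ → ℤ, (∀ t, |(h t : ℝ)| ≤ f.sum fun _ c => |(c : ℝ)|) ∧
      ∀ t, (x : Γ → Tcirc) t = ((l1conv (fun s => (h s : ℝ)) g t : ℝ) : Tcirc) := by
  have hlift : ∀ t, ∃ r : ℝ, |r| ≤ 1 ∧ (r : Tcirc) = (x : Γ → Tcirc) t := fun t => by
    refine ⟨AddCircle.equivIco 1 0 ((x : Γ → Tcirc) t), ?_, AddCircle.coe_equivIco⟩
    have := (AddCircle.equivIco (1 : ℝ) 0 ((x : Γ → Tcirc) t)).2
    rw [Set.mem_Ico] at this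
    rw [abs_le]
    constructor <;> linarith
  choose a ha hax using hlift
  have hint : ∀ t, ∃ n : ℤ, (n : ℝ) = l1conv a (fun s => (f s : ℝ)) t := fun t => by
    have h := x.2 t
    rw [← funext hax, rStarApply_coe, AddCircle.coe_eq_zero_iff] at h
    simpa using h
  choose h hh using hint
  refine ⟨h, fun t => (hh t).symm ▸ abs_l1conv_finsupp_right_le f ha t, fun t => ?_⟩
  rw [funext hh, l1conv_assoc_finsupp_mid f ha hg.1, hg.2.1, l1conv_deltaOne, hax]

/-- For `h` bounded and integral and `g = f⁻¹` in `ℓ¹(Γ)`, the projection of `h ⋆ g` to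
`(ℝ/ℤ)^Γ` lies in `X_f`. -/
theorem coe_l1conv_mem_XfSub {Γ : Type*} [Group Γ] [DecidableEq Γ] {f : Γ →₀ ℤ} {g : Γ → ℝ}
    (hg : IsL1Inverse f g) {h : Γ → ℤ} {C : ℝ} (hC : ∀ t, |(h t : ℝ)| ≤ C) :
    (fun t => ((l1conv (fun s => (h s : ℝ)) g t : ℝ) : Tcirc)) ∈ XfSub f := by
  intro t
  rw [rStarApply_coe, l1conv_assoc_finsupp_right f hC hg.1, hg.2.2, l1conv_deltaOne,
    AddCircle.coe_eq_zero_iff]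
  exact ⟨h t, by simp⟩

/-- `(a ⋆ g) t` and `(b ⋆ g) t` are close if `a` and `b` agree at all `u` such that `u⁻¹ t`
lies in a finite set carrying most of the mass of `g`. -/
theorem abs_l1conv_sub_le {Γ : Type*} [Group Γ] {a b g : Γ → ℝ} {C : ℝ}
    (ha : ∀ u, |a u| ≤ C) (hb : ∀ u, |b u| ≤ C) (hg : Summable fun s => |g s|)
    (W : Finset Γ) (t : Γ) (hab : ∀ u, u⁻¹ * t ∈ W → a u = b u) :
    |l1conv a g t - l1conv b g t| ≤ 2 * C * ∑' s : {s // s ∉ W}, |g s| := by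
  have hind : Summable (({s | s ∉ W} : Set Γ).indicator fun s => |g s|) := hg.indicator _
  let e : Γ ≃ Γ := (Equiv.inv Γ).trans (Equiv.mulRight t)
  rw [l1conv, l1conv,
    ← (summable_mul_translate ha hg t).tsum_sub (summable_mul_translate hb hg t)]
  have htail : ∑' s : {s // s ∉ W}, |g s| =
      ∑' u, ({s | s ∉ W} : Set Γ).indicator (fun s => |g s|) (e u) := by
    rw [e.tsum_eq]
    exact tsum_subtype ({s | s ∉ W} : Set Γ) fun s => |g s|
  rw [htail, ← tsum_mul_left, ← Real.norm_eq_abs]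
  refine tsum_of_norm_bounded ((e.summable_iff.2 hind).mul_left (2 * C)).hasSum fun u => ?_
  rw [← sub_mul, Real.norm_eq_abs, abs_mul]
  by_cases hu : u⁻¹ * t ∈ W
  · rw [hab u hu]
    have : e u ∉ ({s | s ∉ W} : Set Γ) := fun h => h hu
    simp [Set.indicator_of_notMem this]
  · have : e u ∈ ({s | s ∉ W} : Set Γ) := hu
    simp only [Function.comp_apply]
    rw [Set.indicator_of_mem this]
    refine mul_le_mul_of_nonneg_right ?_ (abs_nonneg _)
    have h1 := abs_sub (a u) (b u)
    linarith [ha u, hb u]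

theorem isClosed_XfSub {Γ : Type*} [Group Γ] (f : Γ →₀ ℤ) :
    IsClosed (XfSub f : Set (Γ → Tcirc)) := by
  have : (XfSub f : Set (Γ → Tcirc)) = ⋂ t, {x | rStarApply f x t = 0} := by
    ext x
    simp [XfSub]
  rw [this]
  refine isClosed_iInter fun t => isClosed_eq ?_ continuous_const
  unfold rStarApply Finsupp.sum
  fun_prop

/-- For a compatible metric on `X_f`, points are close as soon as they are close at finitely
many coordinates. -/
theorem exists_finset_mdist_lt {Γ : Type*} [Group Γ] (f : Γ →₀ ℤ)
    (m : MetricSpace (XfSub f)) (hm : mtop m = inferInstanceAs (TopologicalSpace (XfSub f)))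
    {ε : ℝ} (hε : 0 < ε) :
    ∃ (K : Finset Γ) (δ : ℝ), 0 < δ ∧ ∀ x y : XfSub f,
      (∀ t ∈ K, dist ((x : Γ → Tcirc) t) ((y : Γ → Tcirc) t) < δ) → mdist m x y < ε := by
  have : CompactSpace (XfSub f) := isCompact_iff_compactSpace.1 (isClosed_XfSub f).isCompact
  have hu : m.toPseudoMetricSpace.toUniformSpace =
      inferInstanceAs (UniformSpace (XfSub f)) :=
    unique_uniformity_of_compact hm rfl
  have hmem : {p : XfSub f × XfSub f | mdist m p.1 p.2 < ε} ∈ uniformity (XfSub f) := by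
    have := @Metric.dist_mem_uniformity _ m.toPseudoMetricSpace ε hε
    rw [hu] at this
    exact this
  rw [uniformity_subtype, Pi.uniformity] at hmem
  obtain ⟨⟨I, r⟩, ⟨hI, hr⟩, hsub⟩ := ((HasBasis.iInf fun i : Γ =>
    Metric.uniformity_basis_dist.comap fun p : (Γ → Tcirc) × (Γ → Tcirc) =>
      (p.1 i, p.2 i)).comap fun q : XfSub f × XfSub f =>
        ((q.1 : Γ → Tcirc), (q.2 : Γ → Tcirc))).mem_iff.1 hmem
  have hδ : ∀ᶠ δ in 𝓝[>] (0 : ℝ), ∀ i, δ < r i := by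
    have : Finite I := hI
    exact eventually_all.2 fun i => nhdsWithin_le_nhds (eventually_lt_nhds (hr i))
  obtain ⟨δ, hδr, hδ0⟩ := (hδ.and self_mem_nhdsWithin).exists
  refine ⟨hI.toFinset, δ, hδ0, fun x y hxy => @hsub (x, y) ?_⟩
  simp only [Set.mem_preimage, Set.mem_iInter, Set.mem_ofPred_eq]
  exact fun i => (hxy i (hI.mem_toFinset.2 i.2)).trans (hδr i)

/-- Claim 1 of the proof of Theorem 1.2: for `f ∈ ℤΓ` invertible in `ℓ¹(Γ,ℝ)`, the
system `(X_f, α_f)` satisfies the orbit-tracing part of specification: for every `ε > 0`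
there is a nonempty finite `F̃ ⊆ Γ` such that for finite sets `F₁, …, F_m ⊆ Γ` with
`F̃ Fᵢ ∩ F_j = ∅` for `i ≠ j` and points `x¹, …, x^m ∈ X_f` there is `y ∈ X_f` with
`ρ(s xⁱ, s y) ≤ ε` for all `s ∈ Fᵢ`. -/
theorem Xf_tracing {Γ : Type*} [Group Γ] [Countable Γ] [DecidableEq Γ]
    (f : Γ →₀ ℤ) (hf : L1Invertible f)
    (m : MetricSpace (XfSub f)) (hm : mtop m = inferInstanceAs (TopologicalSpace (XfSub f))) :
    ∀ ε : ℝ, 0 < ε → ∃ F : Finset Γ, F.Nonempty ∧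
      ∀ (k : ℕ) (Fs : Fin k → Finset Γ),
        (∀ i j : Fin k, i ≠ j → Disjoint (F * Fs i) (Fs j)) →
        ∀ x : Fin k → XfSub f, ∃ y : XfSub f,
          ∀ i : Fin k, ∀ s ∈ Fs i, mdist m (s • x i) (s • y) ≤ ε := by
  intro ε hε
  obtain ⟨g, hg⟩ := hf
  obtain ⟨K, δ, hδ, hK⟩ := exists_finset_mdist_lt f m hm hε
  set C : ℝ := f.sum fun _ c => |(c : ℝ)| with hC
  have hC0 : 0 ≤ C := Finset.sum_nonneg fun _ _ => abs_nonneg _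
  obtain ⟨W, hW⟩ : ∃ W : Finset Γ, 2 * C * ∑' s : {s // s ∉ W}, |g s| < δ := by
    have h := (tendsto_tsum_compl_atTop_zero fun s => |g s|).const_mul (2 * C)
    rw [mul_zero] at h
    exact (h.eventually_lt_const hδ).exists
  set P : Finset Γ := K * W⁻¹ with hP
  refine ⟨insert 1 (P * P⁻¹), Finset.insert_nonempty _ _, fun k Fs hFs x => ?_⟩
  have huniq : ∀ u i j, ∀ s ∈ Fs i, ∀ s' ∈ Fs j, s * u ∈ P → s' * u ∈ P → i = j := by
    intro u i j s hs s' hs' hu hu'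
    by_contra hij
    refine Finset.disjoint_left.1 (hFs i j hij) ?_ hs'
    have : s' = s' * u * (s * u)⁻¹ * s := by group
    rw [this]
    exact Finset.mul_mem_mul (Finset.mem_insert_of_mem
      (Finset.mul_mem_mul hu' (Finset.inv_mem_inv hu))) hs
  choose h hbd hlift using fun i => exists_int_lift hg (x i)
  obtain ⟨h', hh', hbd'⟩ : ∃ h' : Γ → ℤ, (∀ u i, ∀ s ∈ Fs i, s * u ∈ P → h' u = h i u) ∧
      ∀ u, |(h' u : ℝ)| ≤ C := by
    have : ∀ u, ∃ n : ℤ, (∀ i, ∀ s ∈ Fs i, s * u ∈ P → n = h i u) ∧ |(n : ℝ)| ≤ C := by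
      intro u
      by_cases H : ∃ i, ∃ s ∈ Fs i, s * u ∈ P
      · obtain ⟨i, s, hs, hu⟩ := H
        exact ⟨h i u, fun j s' hs' hu' => by rw [huniq u i j s hs s' hs' hu hu'], hbd i u⟩
      · exact ⟨0, fun i s hs hu => absurd ⟨i, s, hs, hu⟩ H, by simpa using hC0⟩
    choose h' h1 h2 using this
    exact ⟨h', h1, h2⟩
  refine ⟨⟨_, coe_l1conv_mem_XfSub hg hbd'⟩, fun i s hs => (hK _ _ fun t ht => ?_).le⟩
  rw [smul_XfSub_apply, smul_XfSub_apply, hlift, dist_eq_norm, ← AddCircle.coe_sub]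
  refine (QuotientAddGroup.norm_mk_le_norm.trans ?_).trans_lt hW
  refine abs_l1conv_sub_le (hbd i) hbd' hg.1 W _ fun u hu => ?_
  have hsu : s * u ∈ P := by
    have : s * u = t * (u⁻¹ * (s⁻¹ * t))⁻¹ := by group
    rw [this]
    exact Finset.mul_mem_mul ht (Finset.inv_mem_inv hu)
  rw [hh' u i s hs hsu]
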